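/- arXiv:1304.0943 — 4 statements merged into one kernel-verified Lean document; each statement's English description precedes it below -/
import Mathlib

section
/- Let a : ℕ → ℝ be nonnegative and summable, let τ > 0, γ_* > 0, and let g : ℝ → ℝ satisfy τ·|g(t)| ≤ γ_* and t·|g(t)| ≤ γ_* for all t ≥ 0. With the effective dimension N(τ) := ∑'_j a_j/(a_j + τ), one has: (i) ∑'_j g(a_j)²·a_j ≤ 2γ_*²·N(τ)/τ; and (ii) sup_j g(a_j)²·a_j ≤ γ_*²/τ. (Multiplying by σ², (i) bounds the variance S_τ² = σ²·tr(R_τ*R_τ) of the linear regularization R_τ = g_τ(T*T)T* by 2γ_*²σ²N(τ)/τ, and (ii) bounds the weak variance v_τ² = σ²‖R_τ‖² by γ_*²σ²/τ, where (a_j) are the eigenvalues of T*T.) -/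
/-- A filter value `x` with `τ|x| ≤ γ` and `t|x| ≤ γ` satisfies `x² t ≤ γ²/τ`. -/
theorem sq_mul_le_sq_div {t τ γ x : ℝ} (ht : 0 ≤ t) (hτ : 0 < τ)
    (h₁ : τ * |x| ≤ γ) (h₂ : t * |x| ≤ γ) : x ^ 2 * t ≤ γ ^ 2 / τ := by
  rw [le_div_iff₀ hτ, ← sq_abs x]
  calc |x| ^ 2 * t * τ = (τ * |x|) * (t * |x|) := by ring
    _ ≤ γ * γ := mul_le_mul h₁ h₂ (by positivity) ((by positivity : 0 ≤ τ * |x|).trans h₁)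
    _ = γ ^ 2 := by ring

/-- A filter value `x` with `τ|x| ≤ γ` and `t|x| ≤ γ` satisfies
`x² t ≤ (2γ²/τ) · t/(t+τ)`. -/
theorem sq_mul_le_mul_div_add {t τ γ x : ℝ} (ht : 0 ≤ t) (hτ : 0 < τ)
    (h₁ : τ * |x| ≤ γ) (h₂ : t * |x| ≤ γ) :
    x ^ 2 * t ≤ 2 * γ ^ 2 / τ * (t / (t + τ)) := by
  have hsq : (τ * |x|) ^ 2 ≤ γ ^ 2 := pow_le_pow_left₀ (by positivity) h₁ 2
  have hmul := (le_div_iff₀ hτ).1 (sq_mul_le_sq_div ht hτ h₁ h₂)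
  rw [mul_pow, sq_abs] at hsq
  have key : x ^ 2 * (τ * (t + τ)) ≤ 2 * γ ^ 2 := by linarith
  rw [div_mul_div_comm, le_div_iff₀ (by positivity)]
  calc x ^ 2 * t * (τ * (t + τ)) = x ^ 2 * (τ * (t + τ)) * t := by ring
    _ ≤ 2 * γ ^ 2 * t := mul_le_mul_of_nonneg_right key ht

/-- Variance and weak-variance bounds for linear regularization via the effective
dimension `N(τ) = ∑' a_j/(a_j+τ)`: if `τ|g(t)| ≤ γ_*` and `t|g(t)| ≤ γ_*` for all
`t ≥ 0`, then `∑' g(a_j)² a_j ≤ 2γ_*² N(τ)/τ` and `sup_j g(a_j)² a_j ≤ γ_*²/τ`. -/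
theorem stmt_4
    (a : ℕ → ℝ) (ha : ∀ j, 0 ≤ a j) (hsum : Summable a)
    (τ γs : ℝ) (hτ : 0 < τ) (hγs : 0 < γs)
    (g : ℝ → ℝ)
    (hg1 : ∀ t : ℝ, 0 ≤ t → τ * |g t| ≤ γs)
    (hg2 : ∀ t : ℝ, 0 ≤ t → t * |g t| ≤ γs)
    (N : ℝ) (hN : N = ∑' j, a j / (a j + τ)) :
    (∑' j, g (a j) ^ 2 * a j) ≤ 2 * γs ^ 2 * N / τ ∧
      (⨆ j, g (a j) ^ 2 * a j) ≤ γs ^ 2 / τ := by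
  have hterm j : g (a j) ^ 2 * a j ≤ 2 * γs ^ 2 / τ * (a j / (a j + τ)) :=
    sq_mul_le_mul_div_add (ha j) hτ (hg1 _ (ha j)) (hg2 _ (ha j))
  have hdim : Summable fun j => a j / (a j + τ) := by
    refine Summable.of_nonneg_of_le (fun j => ?_) (fun j => ?_) (hsum.div_const τ)
    · exact div_nonneg (ha j) (add_nonneg (ha j) hτ.le)
    · exact div_le_div_of_nonneg_left (ha j) hτ (le_add_of_nonneg_left (ha j))
  have hbound := hdim.mul_left (2 * γs ^ 2 / τ)
  have hvar : Summable fun j => g (a j) ^ 2 * a j :=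
    Summable.of_nonneg_of_le (fun j => mul_nonneg (sq_nonneg _) (ha j)) hterm hbound
  refine ⟨?_, ciSup_le fun j => sq_mul_le_sq_div (ha j) hτ (hg1 _ (ha j)) (hg2 _ (ha j))⟩
  calc ∑' j, g (a j) ^ 2 * a j ≤ ∑' j, 2 * γs ^ 2 / τ * (a j / (a j + τ)) :=
        hvar.tsum_le_tsum hterm hbound
    _ = 2 * γs ^ 2 * N / τ := by rw [tsum_mul_left, hN]; ring
end

section
/- Let a : ℕ → ℝ be nonnegative and summable, N(τ) := ∑'_j a_j/(a_j+τ), and let σ > 0, α, β ∈ (0,1), x_α := log(1/α), x_β := log(1/β), C*_{α,β} := 4√(x_β) + 4√(2x_α). Let (g_τ)_{τ>0} satisfy τ·|g_τ(t)| ≤ γ_* and t·|g_τ(t)| ≤ γ_* for all t ≥ 0, τ > 0, and the qualification bound |1 − t·g_τ(t)|·φ(t) ≤ γ·φ(τ) for all t ≥ 0, τ > 0, where φ is a nonnegative nondecreasing function. Let f be given in eigencoordinates by f_j = φ(a_j)·ω_j with ∑_j ω_j² ≤ 1 (i.e. f ∈ E_φ). For τ > 0 define S_τ² := σ²·∑'_j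 g_τ(a_j)²·a_j, v_τ² := σ²·sup_j g_τ(a_j)²·a_j, r²(τ) := C*_{α,β}·S_τ·v_τ + (4x_α+8x_β)·v_τ², and bias²(τ) := ∑'_j (1 − a_j·g_τ(a_j))²·f_j². If τ_* > 0 satisfies φ²(τ_*) = σ²·√(N(τ_*))/τ_*, then inf_{τ>0} ( r²(τ) + bias²(τ) ) ≤ ( C*_{α,β}·√2·γ_*² + (4x_α+8x_β)·γ_*²/√(N(τ_*)) + γ² )·φ²(τ_*). (This is the main non-asymptotic upper bound on the separation radius of the test based on linear regularization, evaluated at the parameter τ_* balancing φ²(τ) with σ²√N(τ)/τ.) -/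
/-- Pointwise variance bound for a filter value `x = g_τ(t)`. -/
theorem sq_mul_le_of_filter_bounds {τ t x c : ℝ} (hτ : 0 < τ) (ht : 0 ≤ t)
    (h₁ : τ * |x| ≤ c) (h₂ : t * |x| ≤ c) : x ^ 2 * t ≤ c ^ 2 / τ := by
  rw [le_div_iff₀ hτ, ← sq_abs x]
  calc |x| ^ 2 * t * τ = (τ * |x|) * (t * |x|) := by ring
    _ ≤ c * c := mul_le_mul h₁ h₂ (by positivity) (le_trans (by positivity) h₁)
    _ = c ^ 2 := by ring

/-- Pointwise comparison of the variance of a filter with the effective dimension. -/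
theorem sq_mul_le_effective_dim_term {τ t x c : ℝ} (hτ : 0 < τ) (ht : 0 ≤ t)
    (h₁ : τ * |x| ≤ c) (h₂ : t * |x| ≤ c) :
    x ^ 2 * t ≤ 2 * c ^ 2 / τ * (t / (t + τ)) := by
  have hx : x ^ 2 * τ ≤ c ^ 2 / τ := sq_mul_le_of_filter_bounds hτ hτ.le h₁ h₁
  have hxt : x ^ 2 * t ≤ c ^ 2 / τ := sq_mul_le_of_filter_bounds hτ ht h₁ h₂
  rw [← mul_div_assoc, le_div_iff₀ (by positivity)]
  calc x ^ 2 * t * (t + τ) = (x ^ 2 * t + x ^ 2 * τ) * t := by ring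
    _ ≤ (c ^ 2 / τ + c ^ 2 / τ) * t := by gcongr
    _ = 2 * c ^ 2 / τ * t := by ring

/-- The terms of the effective dimension are summable. -/
theorem summable_effective_dim {a : ℕ → ℝ} (ha : ∀ j, 0 ≤ a j) (hsum : Summable a)
    {τ : ℝ} (hτ : 0 < τ) : Summable fun j => a j / (a j + τ) := by
  refine Summable.of_nonneg_of_le (fun j => ?_) (fun j => ?_) (hsum.div_const τ)
  · have := ha j
    positivity
  · have := ha j
    gcongr
    linarith

/-- Main non-asymptotic separation-radius bound for tests based on linear
regularization: with effective dimension `N(τ) = ∑' a_j/(a_j+τ)`, variance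
`S_τ² = σ² ∑' g_τ(a_j)² a_j`, weak variance `v_τ² = σ² sup_j g_τ(a_j)² a_j`,
threshold `r²(τ) = C* S_τ v_τ + (4x_α+8x_β) v_τ²` and bias
`bias²(τ) = ∑' (1 − a_j g_τ(a_j))² f_j²` for `f_j = φ(a_j)ω_j`, `∑ ω_j² ≤ 1`,
if `τ_*` solves `φ²(τ_*) = σ² √(N(τ_*))/τ_*` then
`inf_{τ>0} (r²(τ) + bias²(τ)) ≤ (C*√2 γ_*² + (4x_α+8x_β)γ_*²/√(N(τ_*)) + γ²) φ²(τ_*)`. -/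
theorem stmt_7
    (a : ℕ → ℝ) (ha : ∀ j, 0 ≤ a j) (hsum : Summable a)
    (σ : ℝ) (hσ : 0 < σ)
    (α β : ℝ) (hα : α ∈ Set.Ioo (0 : ℝ) 1) (hβ : β ∈ Set.Ioo (0 : ℝ) 1)
    (xα xβ Cab : ℝ) (hxα : xα = Real.log (1 / α)) (hxβ : xβ = Real.log (1 / β))
    (hCab : Cab = 4 * Real.sqrt xβ + 4 * Real.sqrt (2 * xα))
    (g : ℝ → ℝ → ℝ) (γs γ : ℝ) (hγs : 0 < γs) (hγ : 0 < γ)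
    (hg : ∀ τ : ℝ, 0 < τ → ∀ t : ℝ, 0 ≤ t → τ * |g τ t| ≤ γs ∧ t * |g τ t| ≤ γs)
    (φ : ℝ → ℝ) (hφ0 : ∀ t, 0 ≤ φ t) (hφmono : Monotone φ)
    (hqual : ∀ τ : ℝ, 0 < τ → ∀ t : ℝ, 0 ≤ t → |1 - t * g τ t| * φ t ≤ γ * φ τ)
    (ω : ℕ → ℝ) (hω : Summable fun j => ω j ^ 2) (hω1 : (∑' j, ω j ^ 2) ≤ 1)
    (N S v r2 bias2 : ℝ → ℝ)
    (hN : ∀ τ, N τ = ∑' j, a j / (a j + τ))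
    (hS : ∀ τ, S τ = Real.sqrt (σ ^ 2 * ∑' j, g τ (a j) ^ 2 * a j))
    (hv : ∀ τ, v τ = Real.sqrt (σ ^ 2 * ⨆ j, g τ (a j) ^ 2 * a j))
    (hr2 : ∀ τ, r2 τ = Cab * S τ * v τ + (4 * xα + 8 * xβ) * v τ ^ 2)
    (hbias2 : ∀ τ, bias2 τ = ∑' j, (1 - a j * g τ (a j)) ^ 2 * (φ (a j) * ω j) ^ 2)
    (τs : ℝ) (hτs : 0 < τs)
    (hbal : φ τs ^ 2 = σ ^ 2 * Real.sqrt (N τs) / τs) :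
    (⨅ τ : Set.Ioi (0 : ℝ), (r2 τ + bias2 τ)) ≤
      (Cab * Real.sqrt 2 * γs ^ 2 + (4 * xα + 8 * xβ) * γs ^ 2 / Real.sqrt (N τs)
        + γ ^ 2) * φ τs ^ 2 := by
  have hxα0 : 0 ≤ xα := by
    rw [hxα]
    exact Real.log_nonneg ((one_le_div hα.1).2 hα.2.le)
  have hxβ0 : 0 ≤ xβ := by
    rw [hxβ]
    exact Real.log_nonneg ((one_le_div hβ.1).2 hβ.2.le)
  have hC0 : 0 ≤ Cab := by
    rw [hCab]
    positivity
  have hS0 : ∀ τ, 0 ≤ S τ := fun τ => by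
    rw [hS]
    positivity
  have hv0 : ∀ τ, 0 ≤ v τ := fun τ => by
    rw [hv]
    positivity
  have hbdd : BddBelow (Set.range fun τ : Set.Ioi (0 : ℝ) => r2 τ + bias2 τ) := by
    refine ⟨0, ?_⟩
    rintro _ ⟨τ, rfl⟩
    have hb : 0 ≤ bias2 τ := by
      rw [hbias2]
      exact tsum_nonneg fun j => by positivity
    have hr : 0 ≤ r2 τ := by
      have := hS0 τ
      have := hv0 τ
      rw [hr2]
      positivity
    exact add_nonneg hr hb
  refine (ciInf_le hbdd ⟨τs, hτs⟩).trans ?_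
  have hNsum := summable_effective_dim ha hsum hτs
  have hterm0 : ∀ j, 0 ≤ a j / (a j + τs) := fun j => by
    have := ha j
    positivity
  have hN0 : 0 ≤ N τs := by
    rw [hN]
    exact tsum_nonneg hterm0
  have hgj := fun j => hg τs hτs (a j) (ha j)
  have hvle : v τs ≤ σ * γs / √τs := by
    rw [hv]
    refine Real.sqrt_le_iff.2 ⟨by positivity, ?_⟩
    calc σ ^ 2 * ⨆ j, g τs (a j) ^ 2 * a j ≤ σ ^ 2 * (γs ^ 2 / τs) := by
          gcongr
          exact ciSup_le fun j =>
            sq_mul_le_of_filter_bounds hτs (ha j) (hgj j).1 (hgj j).2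
      _ = (σ * γs / √τs) ^ 2 := by
          rw [div_pow, Real.sq_sqrt hτs.le]
          ring
  have hSle : S τs ≤ σ * γs / √τs * (√2 * √(N τs)) := by
    rw [hS]
    refine Real.sqrt_le_iff.2 ⟨by positivity, ?_⟩
    have hterm : ∀ j, g τs (a j) ^ 2 * a j ≤ 2 * γs ^ 2 / τs * (a j / (a j + τs)) :=
      fun j => sq_mul_le_effective_dim_term hτs (ha j) (hgj j).1 (hgj j).2
    have hmaj := hNsum.mul_left (2 * γs ^ 2 / τs)
    calc σ ^ 2 * ∑' j, g τs (a j) ^ 2 * a j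
        ≤ σ ^ 2 * ∑' j, 2 * γs ^ 2 / τs * (a j / (a j + τs)) :=
          mul_le_mul_of_nonneg_left
            ((Summable.of_nonneg_of_le (fun j => mul_nonneg (sq_nonneg _) (ha j))
              hterm hmaj).tsum_le_tsum hterm hmaj) (sq_nonneg σ)
      _ = (σ * γs / √τs * (√2 * √(N τs))) ^ 2 := by
          rw [tsum_mul_left, ← hN, mul_pow, div_pow, mul_pow (√2), Real.sq_sqrt hτs.le,
            Real.sq_sqrt hN0, Real.sq_sqrt zero_le_two]
          ring
  have hSv : S τs * v τs ≤ √2 * γs ^ 2 * φ τs ^ 2 := by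
    calc S τs * v τs ≤ σ * γs / √τs * (√2 * √(N τs)) * (σ * γs / √τs) :=
          mul_le_mul hSle hvle (hv0 τs) (by positivity)
      _ = σ ^ 2 * γs ^ 2 / √τs ^ 2 * (√2 * √(N τs)) := by ring
      _ = √2 * γs ^ 2 * φ τs ^ 2 := by
          rw [hbal, Real.sq_sqrt hτs.le]
          ring
  have hvv : v τs ^ 2 ≤ γs ^ 2 / √(N τs) * φ τs ^ 2 := by
    rcases hN0.eq_or_lt with h0 | hpos
    · have ha0 : ∀ j, a j = 0 := fun j => by
        have hle : a j / (a j + τs) ≤ 0 := by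
          rw [h0, hN]
          exact hNsum.le_tsum j fun i _ => hterm0 i
        have := ha j
        rcases div_eq_zero_iff.1 (le_antisymm hle (hterm0 j)) with h | h
        · exact h
        · linarith
      have hvz : v τs = 0 := by
        rw [hv]
        simp [ha0]
      rw [hvz, zero_pow two_ne_zero]
      positivity
    · have hsq : 0 < √(N τs) := Real.sqrt_pos.2 hpos
      calc v τs ^ 2 ≤ (σ * γs / √τs) ^ 2 := pow_le_pow_left₀ (hv0 τs) hvle 2
        _ = γs ^ 2 / √(N τs) * φ τs ^ 2 := by
          rw [hbal, div_pow, Real.sq_sqrt hτs.le]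
          field_simp
  have hb : bias2 τs ≤ γ ^ 2 * φ τs ^ 2 := by
    have hterm : ∀ j, (1 - a j * g τs (a j)) ^ 2 * (φ (a j) * ω j) ^ 2
        ≤ γ ^ 2 * φ τs ^ 2 * ω j ^ 2 := fun j => by
      have hq := pow_le_pow_left₀ (mul_nonneg (abs_nonneg _) (hφ0 _))
        (hqual τs hτs (a j) (ha j)) 2
      rw [mul_pow, sq_abs, mul_pow] at hq
      rw [mul_pow (φ (a j)), ← mul_assoc]
      gcongr
    have hmaj := hω.mul_left (γ ^ 2 * φ τs ^ 2)
    rw [hbias2]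
    calc ∑' j, (1 - a j * g τs (a j)) ^ 2 * (φ (a j) * ω j) ^ 2
        ≤ ∑' j, γ ^ 2 * φ τs ^ 2 * ω j ^ 2 :=
          (Summable.of_nonneg_of_le (fun j => by positivity) hterm hmaj).tsum_le_tsum
            hterm hmaj
      _ = γ ^ 2 * φ τs ^ 2 * ∑' j, ω j ^ 2 := tsum_mul_left
      _ ≤ γ ^ 2 * φ τs ^ 2 := mul_le_of_le_one_right (by positivity) hω1
  calc r2 τs + bias2 τs
      = Cab * (S τs * v τs) + (4 * xα + 8 * xβ) * v τs ^ 2 + bias2 τs := by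
        rw [hr2]
        ring
    _ ≤ Cab * (√2 * γs ^ 2 * φ τs ^ 2)
        + (4 * xα + 8 * xβ) * (γs ^ 2 / √(N τs) * φ τs ^ 2) + γ ^ 2 * φ τs ^ 2 := by
        gcongr
    _ = _ := by ring
end

section
/- Let s : ℕ → ℝ be a positive antitone sequence (s_0 ≥ s_1 ≥ … > 0) with ∑_j s_j² < ∞. Then for every m ∈ ℕ, ∑_{j=0}^{m} 1/s_j² ≤ (2/s_m²) · ∑'_{j∈ℕ} s_j²/(s_j² + s_m²). In other words, the partial sums of the reciprocal squared singular values are bounded by twice the effective dimension evaluated at s_m², divided by s_m²: ∑_{j≤m} s_j^{-2} ≤ 2·N(s_m²)/s_m², where N(τ) = ∑'_j s_j²/(s_j²+τ). -/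
theorem one_div_le_two_div_mul_div_add {a b : ℝ} (hb : 0 < b) (hba : b ≤ a) :
    1 / a ≤ 2 / b * (a / (a + b)) := by
  have ha : 0 < a := hb.trans_le hba
  rw [div_mul_div_comm, div_le_div_iff₀ ha (by positivity)]
  nlinarith [mul_le_mul hba hba hb.le ha.le, mul_le_mul_of_nonneg_left hba ha.le]

/-- Partial sums of reciprocal squared singular values are bounded by twice the
effective dimension: for a positive nonincreasing square-summable sequence `s`,
`∑_{j=0}^{m} 1/s_j² ≤ (2/s_m²) ∑' s_j²/(s_j² + s_m²)`. -/
theorem stmt_8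
    (s : ℕ → ℝ) (hpos : ∀ j, 0 < s j) (hant : Antitone s)
    (hsum : Summable fun j => s j ^ 2) :
    ∀ m : ℕ,
      (∑ j ∈ Finset.range (m + 1), 1 / s j ^ 2) ≤
        (2 / s m ^ 2) * ∑' j, s j ^ 2 / (s j ^ 2 + s m ^ 2) := by
  intro m
  have hsq (j : ℕ) : 0 < s j ^ 2 := pow_pos (hpos j) 2
  have hsummable : Summable fun j => s j ^ 2 / (s j ^ 2 + s m ^ 2) := by
    refine Summable.of_nonneg_of_le
      (fun j => div_nonneg (hsq j).le (add_pos (hsq j) (hsq m)).le) (fun j => ?_)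
      (hsum.div_const (s m ^ 2))
    exact div_le_div_of_nonneg_left (hsq j).le (hsq m) (le_add_of_nonneg_left (hsq j).le)
  calc
    (∑ j ∈ Finset.range (m + 1), 1 / s j ^ 2)
        ≤ ∑ j ∈ Finset.range (m + 1), 2 / s m ^ 2 * (s j ^ 2 / (s j ^ 2 + s m ^ 2)) := by
      refine Finset.sum_le_sum fun j hj => one_div_le_two_div_mul_div_add (hsq m) ?_
      exact pow_le_pow_left₀ (hpos m).le (hant (Finset.mem_range_succ_iff.mp hj)) 2
    _ = 2 / s m ^ 2 * ∑ j ∈ Finset.range (m + 1), s j ^ 2 / (s j ^ 2 + s m ^ 2) :=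
      (Finset.mul_sum ..).symm
    _ ≤ 2 / s m ^ 2 * ∑' j, s j ^ 2 / (s j ^ 2 + s m ^ 2) := by
      refine mul_le_mul_of_nonneg_left ?_ (div_pos two_pos (hsq m)).le
      exact hsummable.sum_le_tsum _
        fun j _ => div_nonneg (hsq j).le (add_pos (hsq j) (hsq m)).le
end

section
/- Let b > 0 and let φ : [0,b] → ℝ be continuous, nondecreasing and nonnegative with φ(0) = 0 (an index function); set Θ²(u) := u·φ²(u). Let ψ : [0, Θ²(b)] → ℝ be a concave function satisfying ψ(Θ²(u)) = φ²(u) for all u ∈ [0,b] (i.e. ψ = φ² ∘ (Θ²)^{-1}). Then for every sequence (a_j) with a_j ∈ [0,b] and every sequence (ω_j) with ∑_j ω_j² ≤ 1, ∑'_j φ²(a_j)·ω_j² ≤ ψ( ∑'_j a_j·φ²(a_j)·ω_j² ). In operator terms, this is the interpolation inequality ‖f‖ ≤ φ(Θ^{-1}(‖Tf‖)) for every f in the source set E_φ, since in the eigenbasis of T*T (eigenvalues a_j) one has ‖f‖² = ∑ φ²(a_j)ω_j² and ‖Tf‖² = ∑ a_j φ²(a_j)ω_j² = ∑ Θ²(a_j)ω_j²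 for f = φ(T*T)ω. -/
/-- Jensen's inequality for sub-probability weights: the missing mass is placed at a zero of `f`. -/
theorem ConcaveOn.sum_mul_le_map_sum {ι : Type*} {s : Set ℝ} {f : ℝ → ℝ} (hf : ConcaveOn ℝ s f)
    (hs : 0 ∈ s) (hf0 : f 0 = 0) {t : Finset ι} {w p : ι → ℝ} (hw : ∀ i ∈ t, 0 ≤ w i)
    (hw1 : ∑ i ∈ t, w i ≤ 1) (hp : ∀ i ∈ t, p i ∈ s) :
    ∑ i ∈ t, w i * f (p i) ≤ f (∑ i ∈ t, w i * p i) := by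
  simpa [hf0] using hf.map_add_sum_le (v := 1 - ∑ i ∈ t, w i) (q := 0) hw (by ring) hp
    (sub_nonneg.2 hw1) hs

/-- A function `g` satisfying `g (F u) = h u`, with `F` and `h` monotone on `[c, d]` and `F`
continuous, is monotone on `[F c, F d]`. -/
theorem monotoneOn_Icc_of_comp_eq {F g h : ℝ → ℝ} {c d : ℝ} (hcd : c ≤ d)
    (hFc : ContinuousOn F (Set.Icc c d)) (hF : MonotoneOn F (Set.Icc c d))
    (hh : MonotoneOn h (Set.Icc c d)) (hg : ∀ u ∈ Set.Icc c d, g (F u) = h u) :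
    MonotoneOn g (Set.Icc (F c) (F d)) := by
  intro x hx y hy hxy
  obtain ⟨u, hu, rfl⟩ := intermediate_value_Icc hcd hFc hx
  obtain ⟨v, hv, rfl⟩ := intermediate_value_Icc hcd hFc hy
  rcases le_total u v with huv | hvu
  · rw [hg u hu, hg v hv]
    exact hh hu hv huv
  · rw [le_antisymm hxy (hF hv hu hvu)]

/-- Interpolation inequality (sequence form of `‖f‖ ≤ φ(Θ⁻¹(‖Tf‖))` for
`f ∈ E_φ`): if `φ` is an index function on `[0,b]`, `Θ²(u) = u φ²(u)`, and
`ψ = φ² ∘ (Θ²)⁻¹` is concave on `[0, Θ²(b)]`, then for `a_j ∈ [0,b]` and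
`∑ ω_j² ≤ 1`, `∑' φ²(a_j) ω_j² ≤ ψ(∑' a_j φ²(a_j) ω_j²)`. -/
theorem stmt_10
    (b : ℝ) (hb : 0 < b)
    (φ : ℝ → ℝ) (hφcont : ContinuousOn φ (Set.Icc 0 b))
    (hφmono : MonotoneOn φ (Set.Icc 0 b))
    (hφ0 : ∀ u ∈ Set.Icc (0 : ℝ) b, 0 ≤ φ u) (hφzero : φ 0 = 0)
    (ψ : ℝ → ℝ) (hψconc : ConcaveOn ℝ (Set.Icc 0 (b * φ b ^ 2)) ψ)
    (hψ : ∀ u ∈ Set.Icc (0 : ℝ) b, ψ (u * φ u ^ 2) = φ u ^ 2) :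
    ∀ (a ω : ℕ → ℝ), (∀ j, a j ∈ Set.Icc (0 : ℝ) b) →
      (Summable fun j => ω j ^ 2) → (∑' j, ω j ^ 2) ≤ 1 →
      (∑' j, φ (a j) ^ 2 * ω j ^ 2) ≤ ψ (∑' j, a j * φ (a j) ^ 2 * ω j ^ 2) := by
  intro a ω ha hω hω1
  have h0 : (0 : ℝ) ∈ Set.Icc 0 b := ⟨le_rfl, hb.le⟩
  have hbb : b ∈ Set.Icc 0 b := ⟨hb.le, le_rfl⟩
  have hφsq : MonotoneOn (fun u => φ u ^ 2) (Set.Icc 0 b) := fun u hu v hv huv =>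
    pow_le_pow_left₀ (hφ0 u hu) (hφmono hu hv huv) 2
  have hΘ : MonotoneOn (fun u => u * φ u ^ 2) (Set.Icc 0 b) := fun u hu v hv huv =>
    mul_le_mul huv (hφsq hu hv huv) (sq_nonneg _) hv.1
  have hψmono : MonotoneOn ψ (Set.Icc 0 (b * φ b ^ 2)) := by
    simpa using monotoneOn_Icc_of_comp_eq hb.le (continuousOn_id.mul (hφcont.pow 2)) hΘ hφsq hψ
  have hB : 0 ≤ b * φ b ^ 2 := by positivity
  have hψ0 : ψ 0 = 0 := by simpa [hφzero] using hψ 0 h0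
  have hmem : ∀ j, a j * φ (a j) ^ 2 ∈ Set.Icc 0 (b * φ b ^ 2) := fun j =>
    ⟨mul_nonneg (ha j).1 (sq_nonneg _), hΘ (ha j) hbb (ha j).2⟩
  have hnonneg : ∀ j, 0 ≤ a j * φ (a j) ^ 2 * ω j ^ 2 := fun j =>
    mul_nonneg (hmem j).1 (sq_nonneg _)
  have hle : ∀ j, a j * φ (a j) ^ 2 * ω j ^ 2 ≤ b * φ b ^ 2 * ω j ^ 2 := fun j =>
    mul_le_mul_of_nonneg_right (hmem j).2 (sq_nonneg _)
  have hsum : Summable fun j => a j * φ (a j) ^ 2 * ω j ^ 2 :=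
    .of_nonneg_of_le hnonneg hle (hω.mul_left _)
  have htsum : ∑' j, a j * φ (a j) ^ 2 * ω j ^ 2 ∈ Set.Icc 0 (b * φ b ^ 2) := by
    refine ⟨tsum_nonneg hnonneg, (hsum.tsum_le_tsum hle (hω.mul_left _)).trans ?_⟩
    rw [tsum_mul_left]
    exact mul_le_of_le_one_right hB hω1
  refine Real.tsum_le_of_sum_le (fun j => by positivity) fun t => ?_
  have hfin := hψconc.sum_mul_le_map_sum (t := t) (w := fun j => ω j ^ 2)
    (p := fun j => a j * φ (a j) ^ 2) ⟨le_rfl, hB⟩ hψ0 (fun j _ => sq_nonneg _)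
    ((hω.sum_le_tsum t fun j _ => sq_nonneg _).trans hω1) (fun j _ => hmem j)
  simp only [hψ _ (ha _), mul_comm (ω _ ^ 2)] at hfin
  have hpartial := hsum.sum_le_tsum t fun j _ => hnonneg j
  exact hfin.trans <| hψmono ⟨Finset.sum_nonneg fun j _ => hnonneg j, hpartial.trans htsum.2⟩
    htsum hpartial
end
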